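/- Pfaffian orientation implies determinant formula: let G be a finite simple graph on the 2m vertices {1, …, 2m} with adjacency matrix A, and suppose B is a real antisymmetric matrix (Bᵀ = -B) with B_{s,t} = ±A_{s,t} for all s,t, satisfying the Pfaffian orientation condition: for every permutation σ ∈ S_{2m}, ∏_{j=1}^{m} B_{σ(2j-1),σ(2j)} = sgn(σ) · ∏_{j=1}^{m} A_{σ(2j-1),σ(2j)}. Let w be a symmetric complex weight function and define the complex antisymmetric matrix B^w by B^w_{s,t} = B_{s,t} · w_{s,t}. Then the perfect matching generating function Z = ∑_{M a perfect matching of G} ∏_{{s,t}∈M} w_{s,t} satisfies Z² = det(B^w). -/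

import Mathlib

open Finset Matrix
open scoped Classical

/-- A finset M of unordered pairs of vertices is a perfect matching of the simple
graph G iff every element of M is an edge of G and every vertex belongs to exactly
one element of M. -/
def IsPerfectMatchingFinset {V : Type*} [Fintype V] [DecidableEq V]
    (G : SimpleGraph V) (M : Finset (Sym2 V)) : Prop :=
  (∀ e ∈ M, e ∈ G.edgeSet) ∧ ∀ v : V, ∃! e, e ∈ M ∧ v ∈ e

/-- The unnormalised Pfaffian: the signed sum, over all permutations `σ` of a paired index set,
of the products of the entries of `A` at the pairs permuted by `σ`. -/
def pfaffianSum {ι R : Type*} [Fintype ι] [DecidableEq ι] [CommRing R]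
    (A : Matrix (Fin 2 × ι) (Fin 2 × ι) R) : R :=
  ∑ σ : Equiv.Perm (Fin 2 × ι),
    ((Equiv.Perm.sign σ : ℤ) : R) * ∏ i, A (σ (0, i)) (σ (1, i))

/-- The standard symplectic matrix, with its rows and columns indexed by pairs. -/
def standardAlternating (ι R : Type*) [DecidableEq ι] [CommRing R] :
    Matrix (Fin 2 × ι) (Fin 2 × ι) R :=
  Matrix.blockDiagonal fun _ : ι => !![0, 1; -1, 0]

/-- A permutation of a paired index set preserves the pairs. -/
def PreservesPairs {ι : Type*} (σ : Equiv.Perm (Fin 2 × ι)) : Prop :=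
  ∀ i, (σ (0, i)).2 = (σ (1, i)).2

theorem det_standardAlternating (ι R : Type*) [Fintype ι] [DecidableEq ι] [CommRing R] :
    (standardAlternating ι R).det = 1 := by
  simp [standardAlternating, Matrix.det_blockDiagonal, Matrix.det_fin_two_of]

theorem pfaffianSum_eq_sum_fun {ι R : Type*} [Fintype ι] [DecidableEq ι] [CommRing R]
    (P A : Matrix (Fin 2 × ι) (Fin 2 × ι) R) :
    pfaffianSum (P * A * Pᵀ) =
      ∑ f : Fin 2 × ι → Fin 2 × ι,
        (P.submatrix id f).det * ∏ i, A (f (0, i)) (f (1, i)) := by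
  let E : (Fin 2 × ι → Fin 2 × ι) ≃ (ι → (Fin 2 × ι) × (Fin 2 × ι)) :=
    { toFun := fun f i => (f (0, i), f (1, i))
      invFun := fun g x => if x.1 = 0 then (g x.2).1 else (g x.2).2
      left_inv := by
        intro f
        ext1 ⟨b, i⟩
        fin_cases b <;> simp
      right_inv := by
        intro g
        simp }
  have hentry : ∀ s t, (P * A * Pᵀ) s t = ∑ p : (Fin 2 × ι) × (Fin 2 × ι),
      P s p.1 * A p.1 p.2 * P t p.2 := by
    intro s t
    rw [Fintype.sum_prod_type_right]
    simp [Matrix.mul_apply, Finset.sum_mul]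
  unfold pfaffianSum
  simp only [hentry, Finset.prod_univ_sum, Fintype.piFinset_univ, Finset.mul_sum]
  rw [Finset.sum_comm, ← E.sum_comp]
  refine Finset.sum_congr rfl fun f _ => ?_
  rw [Matrix.det_apply', Finset.sum_mul]
  refine Finset.sum_congr rfl fun σ _ => ?_
  rw [mul_assoc]
  congr 1
  rw [Fintype.prod_prod_type, Fin.prod_univ_two, ← Finset.prod_mul_distrib,
    ← Finset.prod_mul_distrib]
  refine Finset.prod_congr rfl fun i _ => ?_
  simp only [E, Equiv.coe_fn_mk, Matrix.submatrix_apply, id]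
  ring

theorem pfaffianSum_congruence {ι R : Type*} [Fintype ι] [DecidableEq ι] [CommRing R]
    (P A : Matrix (Fin 2 × ι) (Fin 2 × ι) R) :
    pfaffianSum (P * A * Pᵀ) = P.det * pfaffianSum A := by
  rw [pfaffianSum_eq_sum_fun, pfaffianSum, Finset.mul_sum]
  symm
  refine Finset.sum_of_injOn (fun σ : Equiv.Perm (Fin 2 × ι) => (σ : Fin 2 × ι → Fin 2 × ι))
    (fun _ _ _ _ h => DFunLike.coe_injective h) (by simp) ?_ ?_
  · intro f _ hf
    have hinj : ¬ Function.Injective f := fun h => hf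
      ⟨Equiv.ofBijective f (Finite.injective_iff_bijective.1 h), by simp, rfl⟩
    simp only [Function.Injective, not_forall] at hinj
    obtain ⟨a, b, hab, hne⟩ := hinj
    rw [Matrix.det_zero_of_column_eq hne (fun k => by simp [hab]), zero_mul]
  · intro σ _
    rw [Matrix.det_permute']
    ring

theorem exists_sum_of_alternating {V K : Type*} [Field K] [DecidableEq V] (m : ℕ)
    (A : Matrix V V K) (S : Finset V) (hanti : ∀ s t, A s t = -A t s) (hdiag : ∀ s, A s s = 0)
    (hS : ∀ s t, A s t ≠ 0 → s ∈ S) (hcard : S.card ≤ 2 * m) :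
    ∃ u v : Fin m → V → K, ∀ s t, A s t = ∑ i, (u i s * v i t - v i s * u i t) := by
  induction m generalizing A S with
  | zero =>
    have hempty : S = ∅ := Finset.card_eq_zero.1 (by omega)
    refine ⟨fun _ _ => 0, fun _ _ => 0, fun s t => ?_⟩
    by_contra h
    have := hS s t (by simpa using h)
    simp [hempty] at this
  | succ m ih =>
    by_cases hA : ∃ a b, A a b ≠ 0
    · obtain ⟨a, b, hab⟩ := hA
      have hne : a ≠ b := by
        rintro rfl
        exact hab (hdiag a)
      have haS := hS a b hab
      have hbS := hS b a (by rw [hanti]; simpa using hab)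
      let A' : Matrix V V K := fun s t =>
        A s t - (A s b / A a b * A a t - A a s * (A t b / A a b))
      obtain ⟨u, v, huv⟩ := ih A' ((S.erase a).erase b)
        (by
          intro s t
          simp only [A']
          rw [hanti s t]
          ring)
        (by
          intro s
          simp only [A', hdiag]
          ring)
        (by
          intro s t hst
          simp only [Finset.mem_erase]
          refine ⟨?_, ?_, ?_⟩
          · rintro rfl
            apply hst
            simp only [A', hdiag]
            rw [hanti s t]
            field_simp
            ring
          · rintro rfl
            apply hst
            simp only [A', hdiag]
            field_simp
            ring
          · by_contra hs
            have hz : ∀ r, A s r = 0 := fun r => by_contra fun h => hs (hS s r h)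
            apply hst
            simp only [A', hz, hanti a s]
            ring)
        (by
          rw [Finset.card_erase_of_mem (Finset.mem_erase.2 ⟨hne.symm, hbS⟩),
            Finset.card_erase_of_mem haS]
          omega)
      refine ⟨Fin.cons (fun s => A s b / A a b) u, Fin.cons (fun s => A a s) v, fun s t => ?_⟩
      rw [Fin.sum_univ_succ]
      simp only [Fin.cons_zero, Fin.cons_succ]
      rw [← huv]
      simp only [A']
      ring
    · push Not at hA
      exact ⟨fun _ _ => 0, fun _ _ => 0, fun s t => by simp [hA]⟩

theorem exists_congruence_standardAlternating {m : ℕ} {K : Type*} [Field K]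
    (A : Matrix (Fin 2 × Fin m) (Fin 2 × Fin m) K) (hanti : ∀ s t, A s t = -A t s)
    (hdiag : ∀ s, A s s = 0) :
    ∃ P : Matrix (Fin 2 × Fin m) (Fin 2 × Fin m) K,
      A = P * standardAlternating (Fin m) K * Pᵀ := by
  obtain ⟨u, v, huv⟩ := exists_sum_of_alternating m A Finset.univ hanti hdiag (by simp) (by simp)
  refine ⟨Matrix.of fun s x => if x.1 = 0 then u x.2 s else v x.2 s, ?_⟩
  ext s t
  rw [huv]
  simp [Matrix.mul_apply, Fintype.sum_prod_type, standardAlternating, Matrix.blockDiagonal_apply,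
    Finset.sum_sub_distrib]
  ring

theorem PreservesPairs.sign_mul_prod_eq_one {ι R : Type*} [Fintype ι] [DecidableEq ι] [CommRing R]
    {σ : Equiv.Perm (Fin 2 × ι)} (hσ : PreservesPairs σ) :
    ((Equiv.Perm.sign σ : ℤ) : R) *
      ∏ i, standardAlternating ι R (σ (0, i)) (σ (1, i)) = 1 := by
  have hsnd : ∀ b i, (σ (b, i)).2 = (σ (0, i)).2 := by
    intro b i
    fin_cases b
    · rfl
    · exact (hσ i).symm
  have hsurj : Function.Surjective fun i => (σ (0, i)).2 := by
    intro k
    obtain ⟨⟨b, i⟩, h⟩ := σ.surjective (0, k)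
    exact ⟨i, by simp [← hsnd b i, h]⟩
  have hinj : ∀ i, Function.Injective fun b => (σ (b, i)).1 := by
    intro i b c hbc
    have := σ.injective (Prod.ext hbc ((hsnd b i).trans (hsnd c i).symm))
    exact congrArg Prod.fst this
  let π : Equiv.Perm ι := Equiv.ofBijective _ (Finite.surjective_iff_bijective.1 hsurj)
  let ε : ι → Equiv.Perm (Fin 2) := fun i =>
    Equiv.ofBijective _ (Finite.injective_iff_bijective.1 (hinj i))
  have hfactor : σ = Equiv.prodCongrRight (fun _ : Fin 2 => π) * Equiv.prodCongrLeft ε := by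
    ext1 ⟨b, i⟩
    exact Prod.ext rfl (hsnd b i)
  have hsign : Equiv.Perm.sign σ = ∏ i, Equiv.Perm.sign (ε i) := by
    conv_lhs => rw [hfactor]
    simp [Equiv.Perm.sign_prodCongrRight, Equiv.Perm.sign_prodCongrLeft]
  have hperm : ∀ τ : Equiv.Perm (Fin 2),
      (!![0, 1; -1, 0] : Matrix (Fin 2) (Fin 2) ℤ) (τ 0) (τ 1) = Equiv.Perm.sign τ := by
    decide
  have hentry : ∀ i, standardAlternating ι R (σ (0, i)) (σ (1, i)) =
      ((Equiv.Perm.sign (ε i) : ℤ) : R) := by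
    intro i
    rw [← hperm, standardAlternating, Matrix.blockDiagonal_apply, if_pos (hσ i)]
    change _ = (((!![0, 1; -1, 0] : Matrix (Fin 2) (Fin 2) ℤ)
      (σ (0, i)).1 (σ (1, i)).1 : ℤ) : R)
    generalize (σ (0, i)).1 = a
    generalize (σ (1, i)).1 = b
    fin_cases a <;> fin_cases b <;> simp
  rw [Finset.prod_congr rfl fun i _ => hentry i, hsign, Units.coe_prod, Int.cast_prod,
    ← Finset.prod_mul_distrib]
  refine Finset.prod_eq_one fun i _ => ?_
  rw [← Int.cast_mul, ← Units.val_mul, Int.units_mul_self]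
  simp

theorem pfaffianSum_standardAlternating (ι R : Type*) [Fintype ι] [DecidableEq ι] [CommRing R] :
    pfaffianSum (standardAlternating ι R) =
      (#{σ : Equiv.Perm (Fin 2 × ι) | PreservesPairs σ} : R) := by
  rw [pfaffianSum, Finset.card_filter, Nat.cast_sum]
  refine Finset.sum_congr rfl fun σ _ => ?_
  split_ifs with hσ
  · rw [hσ.sign_mul_prod_eq_one, Nat.cast_one]
  · obtain ⟨i, hi⟩ := not_forall.1 hσ
    rw [Finset.prod_eq_zero (Finset.mem_univ i), mul_zero, Nat.cast_zero]
    rw [standardAlternating, Matrix.blockDiagonal_apply, if_neg hi]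

theorem sq_pfaffianSum {m : ℕ} {K : Type*} [Field K]
    (A : Matrix (Fin 2 × Fin m) (Fin 2 × Fin m) K) (hanti : ∀ s t, A s t = -A t s)
    (hdiag : ∀ s, A s s = 0) :
    pfaffianSum A ^ 2 =
      (#{σ : Equiv.Perm (Fin 2 × Fin m) | PreservesPairs σ} : K) ^ 2 * A.det := by
  obtain ⟨P, rfl⟩ := exists_congruence_standardAlternating A hanti hdiag
  rw [pfaffianSum_congruence, pfaffianSum_standardAlternating, Matrix.det_mul, Matrix.det_mul,
    Matrix.det_transpose, det_standardAlternating]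
  ring

/-- The set of pairs of vertices determined by a labelling of the vertices by a paired index
set. -/
def pairing {ι V : Type*} [Fintype ι] [DecidableEq V] (τ : Fin 2 × ι ≃ V) : Finset (Sym2 V) :=
  Finset.univ.image fun i => s(τ (0, i), τ (1, i))

theorem pairing_injective {ι V : Type*} (τ : Fin 2 × ι ≃ V) :
    Function.Injective fun i => s(τ (0, i), τ (1, i)) := by
  intro i j h
  simpa using h

theorem exists_pairing_eq {m : ℕ} {V : Type*} [Fintype V] [DecidableEq V]
    (hV : Fintype.card V = 2 * m) {G : SimpleGraph V} {M : Finset (Sym2 V)}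
    (hM : IsPerfectMatchingFinset G M) : ∃ τ : Fin 2 × Fin m ≃ V, pairing τ = M := by
  choose p q hpq using fun e : Sym2 V => (Sym2.ind (fun a b => ⟨a, b, rfl⟩) e :
    ∃ a b : V, e = s(a, b))
  let f : Fin 2 × M → V := fun x => if x.1 = 0 then p x.2 else q x.2
  have hmem : ∀ x, f x ∈ (x.2 : Sym2 V) := by
    rintro ⟨b, e⟩
    rw [hpq e]
    fin_cases b <;> simp [f]
  have hloop : ∀ e : M, p e ≠ q e := by
    intro e
    have := hM.1 e e.2
    rw [hpq e] at this
    exact G.ne_of_adj this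
  have hf : Function.Bijective f := by
    constructor
    · rintro x y hxy
      have he : x.2 = y.2 := by
        refine Subtype.ext ((hM.2 (f x)).unique ⟨x.2.2, hmem x⟩ ⟨y.2.2, ?_⟩)
        rw [hxy]
        exact hmem y
      obtain ⟨b, e⟩ := x
      obtain ⟨c, e'⟩ := y
      obtain rfl : e = e' := he
      fin_cases b <;> fin_cases c <;>
        first | rfl | exact absurd hxy (hloop e) | exact absurd hxy.symm (hloop e)
    · intro v
      obtain ⟨e, ⟨heM, hve⟩, -⟩ := hM.2 v
      rw [hpq e, Sym2.mem_iff] at hve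
      rcases hve with h | h
      · exact ⟨(0, ⟨e, heM⟩), by simp [f, h]⟩
      · exact ⟨(1, ⟨e, heM⟩), by simp [f, h]⟩
  have hcard : Fintype.card (Fin m) = Fintype.card M := by
    have := Fintype.card_of_bijective hf
    rw [Fintype.card_prod, Fintype.card_fin, hV] at this
    rw [Fintype.card_fin]
    omega
  let E := Fintype.equivOfCardEq hcard
  refine ⟨((Equiv.refl _).prodCongr E).trans (Equiv.ofBijective f hf), ?_⟩
  ext e
  simp only [pairing, Finset.mem_image, Finset.mem_univ, true_and]
  constructor
  · rintro ⟨i, rfl⟩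
    simp [f, ← hpq]
  · intro he
    refine ⟨E.symm ⟨e, he⟩, ?_⟩
    simp [f, ← hpq]

theorem pairing_trans_eq_iff {ι V : Type*} [Fintype ι] [DecidableEq V]
    (σ : Equiv.Perm (Fin 2 × ι)) (τ : Fin 2 × ι ≃ V) :
    pairing (σ.trans τ) = pairing τ ↔ PreservesPairs σ := by
  constructor
  · intro h i
    have hi : s(τ (σ (0, i)), τ (σ (1, i))) ∈ pairing τ := by
      rw [← h]
      exact Finset.mem_image_of_mem _ (Finset.mem_univ i)
    simp only [pairing, Finset.mem_image, Finset.mem_univ, true_and, Sym2.eq_iff,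
      τ.injective.eq_iff] at hi
    obtain ⟨k, ⟨h₀, h₁⟩ | ⟨h₀, h₁⟩⟩ := hi <;> simp [← h₀, ← h₁]
  · intro h
    refine Finset.eq_of_subset_of_card_le ?_ ?_
    · intro e he
      simp only [pairing, Finset.mem_image, Finset.mem_univ, true_and] at he ⊢
      obtain ⟨i, rfl⟩ := he
      refine ⟨(σ (0, i)).2, ?_⟩
      have hne : (σ (0, i)).1 ≠ (σ (1, i)).1 := fun h' => by
        simpa using σ.injective (Prod.ext h' (h i))
      have hi := h i
      simp only [Equiv.trans_apply]
      generalize σ (0, i) = x at *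
      generalize σ (1, i) = y at *
      obtain ⟨b, k⟩ := x
      obtain ⟨c, l⟩ := y
      obtain rfl : k = l := hi
      fin_cases b <;> fin_cases c <;> simp_all [Sym2.eq_swap]
    · rw [pairing, pairing, Finset.card_image_of_injective _ (pairing_injective _),
        Finset.card_image_of_injective _ (pairing_injective _)]

theorem card_pairing_eq {m : ℕ} {V : Type*} [Fintype V] [DecidableEq V]
    (hV : Fintype.card V = 2 * m) {G : SimpleGraph V} {M : Finset (Sym2 V)}
    (hM : IsPerfectMatchingFinset G M) :
    #{τ : Fin 2 × Fin m ≃ V | pairing τ = M} =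
      #{σ : Equiv.Perm (Fin 2 × Fin m) | PreservesPairs σ} := by
  obtain ⟨τ, rfl⟩ := exists_pairing_eq hV hM
  symm
  refine Finset.card_bij (fun σ _ => σ.trans τ) ?_ ?_ ?_
  · intro σ hσ
    simpa [pairing_trans_eq_iff] using hσ
  · intro σ _ σ' _ h
    ext1 x
    exact τ.injective (DFunLike.congr_fun h x)
  · intro τ' hτ'
    have h : (τ'.trans τ.symm).trans τ = τ' := by
      ext1 x
      simp
    refine ⟨τ'.trans τ.symm, ?_, h⟩
    rw [Finset.mem_filter] at hτ' ⊢
    exact ⟨Finset.mem_univ _, (pairing_trans_eq_iff _ τ).1 (by rw [h]; exact hτ'.2)⟩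

theorem isPerfectMatchingFinset_pairing {ι V : Type*} [Fintype ι] [Fintype V] [DecidableEq V]
    {G : SimpleGraph V} {τ : Fin 2 × ι ≃ V} (h : ∀ i, G.Adj (τ (0, i)) (τ (1, i))) :
    IsPerfectMatchingFinset G (pairing τ) := by
  constructor
  · intro e he
    simp only [pairing, Finset.mem_image, Finset.mem_univ, true_and] at he
    obtain ⟨i, rfl⟩ := he
    exact h i
  · intro v
    obtain ⟨⟨b, i⟩, rfl⟩ := τ.surjective v
    refine ⟨s(τ (0, i), τ (1, i)), ⟨Finset.mem_image_of_mem _ (Finset.mem_univ i), ?_⟩, ?_⟩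
    · fin_cases b <;> simp
    · rintro e ⟨he, hv⟩
      simp only [pairing, Finset.mem_image, Finset.mem_univ, true_and] at he
      obtain ⟨j, rfl⟩ := he
      obtain rfl : i = j := by
        rw [Sym2.mem_iff, τ.injective.eq_iff, τ.injective.eq_iff] at hv
        rcases hv with hv | hv <;> exact congrArg Prod.snd hv
      rfl

theorem sum_labelling_eq_sum_perfectMatching {m : ℕ} {V R : Type*} [Fintype V] [DecidableEq V]
    [CommRing R] (hV : Fintype.card V = 2 * m) (G : SimpleGraph V) [DecidableRel G.Adj]
    (f : Sym2 V → R) :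
    ∑ τ : Fin 2 × Fin m ≃ V, ∏ i, (if G.Adj (τ (0, i)) (τ (1, i)) then
        f s(τ (0, i), τ (1, i)) else 0) =
      (#{σ : Equiv.Perm (Fin 2 × Fin m) | PreservesPairs σ} : R) *
        ∑ M with IsPerfectMatchingFinset G M, ∏ e ∈ M, f e := by
  have hterm : ∀ τ : Fin 2 × Fin m ≃ V,
      ∏ i, (if G.Adj (τ (0, i)) (τ (1, i)) then f s(τ (0, i), τ (1, i)) else 0) =
        if IsPerfectMatchingFinset G (pairing τ) then ∏ e ∈ pairing τ, f e else 0 := by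
    intro τ
    split_ifs with h
    · rw [pairing, Finset.prod_image (pairing_injective τ).injOn]
      refine Finset.prod_congr rfl fun i _ => if_pos ?_
      exact h.1 _ (Finset.mem_image_of_mem _ (Finset.mem_univ i))
    · obtain ⟨i, hi⟩ := not_forall.1 (mt isPerfectMatchingFinset_pairing h)
      exact Finset.prod_eq_zero (Finset.mem_univ i) (if_neg hi)
  rw [Finset.sum_congr rfl fun τ _ => hterm τ, ← Finset.sum_filter, Finset.mul_sum,
    ← Finset.sum_fiberwise_of_maps_to (g := pairing)
      (t := {M : Finset (Sym2 V) | IsPerfectMatchingFinset G M}) (by simp)]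
  refine Finset.sum_congr rfl fun M hM => ?_
  have hM' : IsPerfectMatchingFinset G M := (Finset.mem_filter.1 hM).2
  rw [Finset.sum_congr (g := fun _ => ∏ e ∈ M, f e) rfl
      fun τ hτ => by rw [(Finset.mem_filter.1 hτ).2],
    Finset.sum_const, nsmul_eq_mul, ← card_pairing_eq hV hM', Finset.filter_filter]
  congr 3
  ext τ
  simp only [Finset.mem_filter, Finset.mem_univ, true_and]
  exact ⟨fun h => h.2, fun h => ⟨h ▸ hM', h⟩⟩

/-- The equivalence sending `(b, j)` to `2 * j + b`. -/
def pairIndexEquiv (m : ℕ) : Fin 2 × Fin m ≃ Fin (2 * m) :=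
  (Equiv.prodComm _ _).trans (finProdFinEquiv.trans (finCongr (Nat.mul_comm m 2)))

theorem pairIndexEquiv_zero {m : ℕ} (j : Fin m) (h : 2 * (j : ℕ) < 2 * m) :
    pairIndexEquiv m (0, j) = ⟨2 * (j : ℕ), h⟩ := by
  ext
  simp [pairIndexEquiv]

theorem pairIndexEquiv_one {m : ℕ} (j : Fin m) (h : 2 * (j : ℕ) + 1 < 2 * m) :
    pairIndexEquiv m (1, j) = ⟨2 * (j : ℕ) + 1, h⟩ := by
  ext
  simp [pairIndexEquiv, add_comm]

/-- Pfaffian orientation implies the determinant formula: let G be a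
simple graph on 2m vertices with adjacency matrix A, let B be a real antisymmetric
matrix with B_{s,t} = ±A_{s,t} satisfying the Pfaffian orientation condition
∏_j B_{σ(2j-1),σ(2j)} = sgn(σ)·∏_j A_{σ(2j-1),σ(2j)} for every σ ∈ S_{2m}, let w be
a symmetric complex weight function and B^w_{s,t} = B_{s,t}·w_{s,t}. Then the perfect
matching generating function Z = ∑_{M} ∏_{{s,t}∈M} w_{s,t} satisfies Z² = det(B^w). -/
theorem pfaffian_orientation_determinant_formula (m : ℕ)
    (G : SimpleGraph (Fin (2 * m))) [DecidableRel G.Adj]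
    (A : Matrix (Fin (2 * m)) (Fin (2 * m)) ℝ)
    (hA : ∀ s t, A s t = if G.Adj s t then 1 else 0)
    (B : Matrix (Fin (2 * m)) (Fin (2 * m)) ℝ)
    (hBanti : Bᵀ = -B)
    (hBA : ∀ s t, B s t = A s t ∨ B s t = -A s t)
    (hPf : ∀ σ : Equiv.Perm (Fin (2 * m)),
        (∏ j : Fin m, B (σ ⟨2 * (j : ℕ), by have := j.isLt; omega⟩)
                        (σ ⟨2 * (j : ℕ) + 1, by have := j.isLt; omega⟩))
        = (Equiv.Perm.sign σ : ℝ) *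
          ∏ j : Fin m, A (σ ⟨2 * (j : ℕ), by have := j.isLt; omega⟩)
                         (σ ⟨2 * (j : ℕ) + 1, by have := j.isLt; omega⟩))
    (w : Fin (2 * m) → Fin (2 * m) → ℂ) (hw : ∀ s t, w s t = w t s)
    (Bw : Matrix (Fin (2 * m)) (Fin (2 * m)) ℂ)
    (hBw : ∀ s t, Bw s t = (B s t : ℂ) * w s t)
    (Z : ℂ)
    (hZ : Z = ∑ M ∈ Finset.univ.filter (fun M : Finset (Sym2 (Fin (2 * m))) =>
          IsPerfectMatchingFinset G M),
        ∏ e ∈ M, Sym2.lift ⟨w, fun a b => hw a b⟩ e) :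
    Z ^ 2 = Bw.det := by
  let e := pairIndexEquiv m
  have hanti : ∀ s t, B s t = -B t s := fun s t => congrFun (congrFun hBanti t) s
  have hterm : ∀ σ : Equiv.Perm (Fin 2 × Fin m),
      ((Equiv.Perm.sign σ : ℤ) : ℂ) * ∏ i, Bw.submatrix e e (σ (0, i)) (σ (1, i)) =
        ∏ i, (if G.Adj (e (σ (0, i))) (e (σ (1, i))) then
          Sym2.lift ⟨w, fun a b => hw a b⟩ s(e (σ (0, i)), e (σ (1, i))) else 0) := by
    intro σ
    have h := hPf (e.permCongr σ)
    simp only [← pairIndexEquiv_zero, ← pairIndexEquiv_one, Equiv.Perm.sign_permCongr,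
      Equiv.permCongr_apply] at h
    simp only [e, Equiv.symm_apply_apply] at h
    have hsq : ((Equiv.Perm.sign σ : ℤ) : ℂ) * ((Equiv.Perm.sign σ : ℤ) : ℂ) = 1 := by
      rw [← Int.cast_mul, ← Units.val_mul, Int.units_mul_self]
      simp
    have hc := congrArg (fun x : ℝ => (x : ℂ)) h
    push_cast at hc
    simp only [Matrix.submatrix_apply, hBw, Finset.prod_mul_distrib, e]
    rw [hc, ← mul_assoc, ← mul_assoc, hsq, one_mul, ← Finset.prod_mul_distrib]
    refine Finset.prod_congr rfl fun i _ => ?_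
    rw [hA]
    split_ifs <;> simp
  have hsum : pfaffianSum (Bw.submatrix e e) =
      (#{σ : Equiv.Perm (Fin 2 × Fin m) | PreservesPairs σ} : ℂ) * Z := by
    rw [hZ, ← sum_labelling_eq_sum_perfectMatching (Fintype.card_fin _) G, pfaffianSum,
      Finset.sum_congr rfl fun σ _ => hterm σ]
    exact Fintype.sum_equiv ((Equiv.refl _).equivCongr e) _ _ fun σ => rfl
  have hsq := sq_pfaffianSum (Bw.submatrix e e)
    (by
      intro s t
      simp only [Matrix.submatrix_apply, hBw]
      rw [hanti, hw]
      push_cast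
      ring)
    (by
      intro s
      have : B (e s) (e s) = 0 := self_eq_neg.1 (hanti _ _)
      simp [hBw, this])
  rw [hsum, Matrix.det_submatrix_equiv_self, mul_pow] at hsq
  refine mul_left_cancel₀ (pow_ne_zero 2 ?_) hsq
  rw [Nat.cast_ne_zero]
  exact Finset.card_ne_zero_of_mem (a := 1)
    (Finset.mem_filter.2 ⟨Finset.mem_univ _, fun _ => rfl⟩)
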